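/- arXiv:2110.04382 — 2 statements merged into one kernel-verified Lean document; each statement's English description precedes it below -/
import Mathlib

section
/- The DPK limit does not depend on the order in which the data are collected: if (x_j) and (x'_j) are two injective sequences exhausting the same countable set 𝒳, and P̃ and P̃' denote the respective total-variation limits of the DPK sequences built from the same prior P, the same map X, and the same measure Q, then P̃ = P̃'. -/
open MeasureTheory Finset
open scoped Classical

/-- Guarded conditional of a real-valued set function: `μ(A ∩ E)/μ(E)` when `μ(E) > 0`,
and `0` otherwise. -/
noncomputable def dpkCond {Ω : Type*} (μ : Set Ω → ℝ) (A E : Set Ω) : ℝ :=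
  if 0 < μ E then μ (A ∩ E) / μ E else 0

/-- The finite set of values of `𝒳` observed among the first `n` data points. -/
noncomputable def obsSet {𝒳 : Type*} (x : ℕ → 𝒳) (n : ℕ) : Finset 𝒳 :=
  (Finset.range n).image x

/-- The remainder set of the partition `𝓔_n`: the points of `Ω` whose `X`-value has not
been observed among the first `n` data points. -/
def dpkRem {Ω 𝒳 : Type*} (X : Ω → 𝒳) (x : ℕ → 𝒳) (n : ℕ) : Set Ω :=
  X ⁻¹' ((obsSet x n : Set 𝒳)ᶜ)

/-- The DPK sequence: `P_{𝓔_0} := P` and, for `n ≥ 1`,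
`P_{𝓔_n}(A) := ∑_{E ∈ 𝓔_n, P_{𝓔_{n−1}}(E) > 0} (P_{𝓔_{n−1}}(A ∩ E)/P_{𝓔_{n−1}}(E)) · w_n(E)`,
where `𝓔_n` consists of the sets `X⁻¹{x_j}` for the observed values `x_1, …, x_n` together
with the remainder, with weights `Q(X⁻¹{x_j})` and `1 − ∑_j Q(X⁻¹{x_j})` respectively. -/
noncomputable def dpkSeq {Ω 𝒳 : Type*} [MeasurableSpace Ω]
    (P Q : Measure Ω) (X : Ω → 𝒳) (x : ℕ → 𝒳) : ℕ → Set Ω → ℝ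
  | 0 => fun A => (P A).toReal
  | n + 1 => fun A =>
      (∑ v ∈ obsSet x (n + 1),
        dpkCond (dpkSeq P Q X x n) A (X ⁻¹' {v}) * (Q (X ⁻¹' {v})).toReal)
      + dpkCond (dpkSeq P Q X x n) A (dpkRem X x (n + 1))
          * (1 - ∑ v ∈ obsSet x (n + 1), (Q (X ⁻¹' {v})).toReal)

/-- Total variation distance between real-valued set functions:
`sup_{A ∈ F} |μ(A) − ν(A)|`. -/
noncomputable def dTVfun {Ω : Type*} [MeasurableSpace Ω] (μ ν : Set Ω → ℝ) : ℝ :=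
  ⨆ A : {s : Set Ω // MeasurableSet s}, |μ A.1 - ν A.1|

/-- The DPK sequence as a sequence of measures. -/
noncomputable def dpkMeasure {Ω 𝒳 : Type*} [MeasurableSpace Ω]
    (P Q : Measure Ω) (X : Ω → 𝒳) (x : ℕ → 𝒳) : ℕ → Measure Ω
  | 0 => P
  | n + 1 =>
      (∑ v ∈ obsSet x (n + 1),
        Q (X ⁻¹' {v}) • ProbabilityTheory.cond (dpkMeasure P Q X x n) (X ⁻¹' {v}))
      + Q (dpkRem X x (n + 1)) •
          ProbabilityTheory.cond (dpkMeasure P Q X x n) (dpkRem X x (n + 1))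

lemma real_cond_apply {Ω : Type*} [MeasurableSpace Ω] (μ : Measure Ω)
    {E : Set Ω} (hE : MeasurableSet E) (A : Set Ω) :
    (ProbabilityTheory.cond μ E).real A = μ.real (A ∩ E) / μ.real E := by
  simp only [Measure.real, ProbabilityTheory.cond_apply hE, ENNReal.toReal_mul, ENNReal.toReal_inv,
    Set.inter_comm E A]
  rw [div_eq_inv_mul]

lemma dpkCond_real {Ω : Type*} [MeasurableSpace Ω] (μ : Measure Ω)
    {E : Set Ω} (hE : MeasurableSet E) (A : Set Ω) :
    dpkCond μ.real A E = (ProbabilityTheory.cond μ E).real A := by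
  rw [real_cond_apply μ hE, dpkCond]
  split_ifs with h
  · rfl
  · rw [le_antisymm (not_lt.1 h) measureReal_nonneg, div_zero]

lemma preimage_coe_obsSet {Ω 𝒳 : Type*} (X : Ω → 𝒳) (x : ℕ → 𝒳) (n : ℕ) :
    X ⁻¹' (obsSet x n : Set 𝒳) = ⋃ v ∈ obsSet x n, X ⁻¹' {v} := by
  ext ω
  simp

section

variable {Ω 𝒳 : Type*} [MeasurableSpace Ω] {P Q : Measure Ω} {X : Ω → 𝒳}

lemma measurableSet_dpkRem (hX : ∀ v, MeasurableSet (X ⁻¹' {v})) (x : ℕ → 𝒳) (n : ℕ) :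
    MeasurableSet (dpkRem X x n) := by
  rw [dpkRem, Set.preimage_compl, preimage_coe_obsSet]
  exact (Finset.measurableSet_biUnion _ fun v _ => hX v).compl

lemma real_dpkRem [IsProbabilityMeasure Q] (hX : ∀ v, MeasurableSet (X ⁻¹' {v}))
    (x : ℕ → 𝒳) (n : ℕ) :
    Q.real (dpkRem X x n) = 1 - ∑ v ∈ obsSet x n, Q.real (X ⁻¹' {v}) := by
  rw [dpkRem, Set.preimage_compl, preimage_coe_obsSet,
    probReal_compl_eq_one_sub (Finset.measurableSet_biUnion _ fun v _ => hX v),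
    measureReal_biUnion_finset]
  · intro v _ w _ hvw
    exact Disjoint.preimage X (Set.disjoint_singleton.2 hvw)
  · exact fun v _ => hX v

instance isFiniteMeasure_dpkMeasure [IsFiniteMeasure P] [IsFiniteMeasure Q] (x : ℕ → 𝒳) (n : ℕ) :
    IsFiniteMeasure (dpkMeasure P Q X x n) := by
  cases n with
  | zero => simpa only [dpkMeasure]
  | succ n =>
    have h (E : Set Ω) :
        IsFiniteMeasure (Q E • ProbabilityTheory.cond (dpkMeasure P Q X x n) E) :=
      Measure.smul_finite _ (measure_ne_top Q E)
    rw [dpkMeasure]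
    infer_instance

lemma real_dpkMeasure_succ [IsFiniteMeasure P] [IsFiniteMeasure Q]
    (hX : ∀ v, MeasurableSet (X ⁻¹' {v})) (x : ℕ → 𝒳) (n : ℕ) (A : Set Ω) :
    (dpkMeasure P Q X x (n + 1)).real A =
      (∑ v ∈ obsSet x (n + 1), (dpkMeasure P Q X x n).real (A ∩ X ⁻¹' {v}) /
        (dpkMeasure P Q X x n).real (X ⁻¹' {v}) * Q.real (X ⁻¹' {v}))
      + (dpkMeasure P Q X x n).real (A ∩ dpkRem X x (n + 1)) /
        (dpkMeasure P Q X x n).real (dpkRem X x (n + 1)) * Q.real (dpkRem X x (n + 1)) := by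
  have hR := measurableSet_dpkRem hX x (n + 1)
  have h (E : Set Ω) :
      IsFiniteMeasure (Q E • ProbabilityTheory.cond (dpkMeasure P Q X x n) E) :=
    Measure.smul_finite _ (measure_ne_top Q E)
  rw [dpkMeasure, measureReal_add_apply, measureReal_ennreal_smul_apply, real_cond_apply _ hR,
    mul_comm (Q _).toReal]
  congr 1
  rw [Measure.real, Measure.finsetSum_apply, ENNReal.toReal_sum (fun v _ => measure_ne_top _ _)]
  refine Finset.sum_congr rfl fun v _ => ?_
  rw [← real_cond_apply _ (hX v), mul_comm]
  exact measureReal_ennreal_smul_apply _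

lemma dpkSeq_eq_real [IsProbabilityMeasure P] [IsProbabilityMeasure Q]
    (hX : ∀ v, MeasurableSet (X ⁻¹' {v})) (x : ℕ → 𝒳) (n : ℕ) :
    dpkSeq P Q X x n = (dpkMeasure P Q X x n).real := by
  induction n with
  | zero => rfl
  | succ n ih =>
    funext A
    have hR := measurableSet_dpkRem hX x (n + 1)
    rw [real_dpkMeasure_succ hX, dpkSeq, ih]
    beta_reduce
    rw [dpkCond_real _ hR, real_cond_apply _ hR,
      real_dpkRem (Q := Q) hX]
    congr 1
    refine Finset.sum_congr rfl fun v _ => ?_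
    rw [dpkCond_real _ (hX v), real_cond_apply _ (hX v)]
    rfl

/-- On each fibre of `X` the DPK measures are positive multiples of the prior, and the multiple
is `Q (X ⁻¹' {v}) / P (X ⁻¹' {v})` as soon as `v` has been observed. -/
lemma exists_real_dpkMeasure_inter_eq_mul [IsProbabilityMeasure P] [IsProbabilityMeasure Q]
    (hX : ∀ v, MeasurableSet (X ⁻¹' {v})) (hQ : ∀ v, 0 < Q.real (X ⁻¹' {v}))
    (hP : ∀ v, 0 < P.real (X ⁻¹' {v})) (x : ℕ → 𝒳) (n : ℕ) (v : 𝒳) :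
    ∃ c : ℝ, 0 < c ∧
      (∀ A, (dpkMeasure P Q X x n).real (A ∩ X ⁻¹' {v}) = c * P.real (A ∩ X ⁻¹' {v})) ∧
      (v ∈ obsSet x n → c = Q.real (X ⁻¹' {v}) / P.real (X ⁻¹' {v})) := by
  induction n with
  | zero => exact ⟨1, one_pos, fun A => by simp [dpkMeasure], fun h => by simp [obsSet] at h⟩
  | succ n ih =>
    obtain ⟨c, hc, hcA, -⟩ := ih
    set ν := dpkMeasure P Q X x n with hν
    have hνv : ν.real (X ⁻¹' {v}) = c * P.real (X ⁻¹' {v}) := by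
      simpa using hcA Set.univ
    have hne (A : Set Ω) {w : 𝒳} (hw : w ≠ v) : (A ∩ X ⁻¹' {v}) ∩ X ⁻¹' {w} = ∅ := by
      rw [Set.inter_assoc, (Disjoint.preimage X (Set.disjoint_singleton.2 hw.symm)).inter_eq,
        Set.inter_empty]
    by_cases hv : v ∈ obsSet x (n + 1)
    · refine ⟨_, div_pos (hQ v) (hP v), fun A => ?_, fun _ => rfl⟩
      have hR : (A ∩ X ⁻¹' {v}) ∩ dpkRem X x (n + 1) = ∅ := by
        rw [Set.inter_assoc, dpkRem, ← Set.preimage_inter, Set.singleton_inter_eq_empty.2 (by simpa),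
          Set.preimage_empty, Set.inter_empty]
      rw [real_dpkMeasure_succ hX, hR, Finset.sum_eq_single_of_mem v hv]
      · rw [← hν, Set.inter_assoc, Set.inter_self, hcA, hνv]
        have := (hP v).ne'
        simp only [measureReal_empty, zero_div, zero_mul, add_zero]
        field_simp
      · intro w _ hw
        simp [hne A hw]
    · have hsub : X ⁻¹' {v} ⊆ dpkRem X x (n + 1) :=
        Set.preimage_mono (Set.singleton_subset_iff.2 (by simpa))
      have hνR : 0 < ν.real (dpkRem X x (n + 1)) :=
        (hνv ▸ mul_pos hc (hP v)).trans_le (measureReal_mono hsub)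
      have hQR : 0 < Q.real (dpkRem X x (n + 1)) := (hQ v).trans_le (measureReal_mono hsub)
      refine ⟨c / ν.real (dpkRem X x (n + 1)) * Q.real (dpkRem X x (n + 1)), by positivity,
        fun A => ?_, fun h => absurd h hv⟩
      rw [real_dpkMeasure_succ hX, Finset.sum_eq_zero, ← hν, Set.inter_assoc,
        Set.inter_eq_left.2 hsub, hcA]
      · ring
      · intro w hw
        simp [hne A (ne_of_mem_of_not_mem hw hv)]

lemma abs_sub_le_dTVfun (μ ν : Measure Ω) [IsFiniteMeasure μ] [IsFiniteMeasure ν]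
    {A : Set Ω} (hA : MeasurableSet A) :
    |μ.real A - ν.real A| ≤ dTVfun μ.real ν.real := by
  refine le_ciSup (f := fun A : {s : Set Ω // MeasurableSet s} => |μ.real A.1 - ν.real A.1|)
    ⟨μ.real Set.univ + ν.real Set.univ, ?_⟩ ⟨A, hA⟩
  rintro _ ⟨B, rfl⟩
  refine (abs_sub _ _).trans ?_
  rw [abs_of_nonneg measureReal_nonneg, abs_of_nonneg measureReal_nonneg]
  exact add_le_add (measureReal_mono (Set.subset_univ _)) (measureReal_mono (Set.subset_univ _))

/-- A total variation limit of the DPK sequence is determined on each fibre of `X`. -/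
lemma real_inter_of_tendsto_dTVfun_dpkSeq [IsProbabilityMeasure P] [IsProbabilityMeasure Q]
    (hX : ∀ v, MeasurableSet (X ⁻¹' {v})) (hQ : ∀ v, 0 < Q.real (X ⁻¹' {v}))
    (hP : ∀ v, 0 < P.real (X ⁻¹' {v})) {x : ℕ → 𝒳} (hx : Function.Surjective x)
    {Pt : Measure Ω} [IsFiniteMeasure Pt]
    (hlim : Filter.Tendsto (fun n => dTVfun (dpkSeq P Q X x n) Pt.real) Filter.atTop (nhds 0))
    {A : Set Ω} (hA : MeasurableSet A) (v : 𝒳) :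
    Pt.real (A ∩ X ⁻¹' {v}) =
      Q.real (X ⁻¹' {v}) / P.real (X ⁻¹' {v}) * P.real (A ∩ X ⁻¹' {v}) := by
  have hlimA : Filter.Tendsto (fun n => (dpkMeasure P Q X x n).real (A ∩ X ⁻¹' {v}))
      Filter.atTop (nhds (Pt.real (A ∩ X ⁻¹' {v}))) := by
    refine tendsto_iff_dist_tendsto_zero.2 (squeeze_zero (fun _ => dist_nonneg) (fun n => ?_) hlim)
    rw [dpkSeq_eq_real hX, Real.dist_eq]
    exact abs_sub_le_dTVfun _ _ (hA.inter (hX v))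
  obtain ⟨k, rfl⟩ := hx v
  refine tendsto_nhds_unique hlimA (tendsto_const_nhds.congr' ?_)
  filter_upwards [Filter.eventually_gt_atTop k] with n hn
  obtain ⟨c, -, hc, hobs⟩ := exists_real_dpkMeasure_inter_eq_mul hX hQ hP x n (x k)
  rw [hc, hobs (Finset.mem_image_of_mem x (Finset.mem_range.2 hn))]

end

/-- the DPK limit does not depend on the order in which the data are
collected: if `x` and `x'` are two injective sequences exhausting the same countable set
`𝒳`, and `P̃`, `P̃'` are the respective total-variation limits of the DPK sequences built
from the same prior `P`, the same map `X`, and the same measure `Q`, then `P̃ = P̃'`. -/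
theorem dpkSeq_limit_order_independent
    {Ω 𝒳 : Type*} [MeasurableSpace Ω] [Countable 𝒳] [Nonempty 𝒳]
    (P Q : Measure Ω) [IsProbabilityMeasure P] [IsProbabilityMeasure Q]
    (X : Ω → 𝒳) (hXmeas : ∀ v : 𝒳, MeasurableSet (X ⁻¹' {v}))
    (hXsurj : Function.Surjective X)
    (hQpos : ∀ v : 𝒳, 0 < Q (X ⁻¹' {v}))
    (hPpos : ∀ v : 𝒳, 0 < P (X ⁻¹' {v}))
    (x x' : ℕ → 𝒳)
    (hxsurj : Function.Surjective x)
    (hxinj : ∀ i j : ℕ, i < j → x i = x j → ∀ v : 𝒳, ∃ k < j, x k = v)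
    (hx'surj : Function.Surjective x')
    (hx'inj : ∀ i j : ℕ, i < j → x' i = x' j → ∀ v : 𝒳, ∃ k < j, x' k = v)
    (Pt Pt' : Measure Ω) [IsProbabilityMeasure Pt] [IsProbabilityMeasure Pt']
    (hlim : Filter.Tendsto
      (fun n => dTVfun (dpkSeq P Q X x n) (fun A => (Pt A).toReal))
      Filter.atTop (nhds 0))
    (hlim' : Filter.Tendsto
      (fun n => dTVfun (dpkSeq P Q X x' n) (fun A => (Pt' A).toReal))
      Filter.atTop (nhds 0)) :
    Pt = Pt' := by
  have hQ (v : 𝒳) : 0 < Q.real (X ⁻¹' {v}) := ENNReal.toReal_pos (hQpos v).ne' (measure_ne_top _ _)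
  have hP (v : 𝒳) : 0 < P.real (X ⁻¹' {v}) := ENNReal.toReal_pos (hPpos v).ne' (measure_ne_top _ _)
  have hcover : ⋃ v, X ⁻¹' {v} = Set.univ := by
    ext ω
    simp
  refine (Measure.ext_iff_of_iUnion_eq_univ hcover).2 fun v => Measure.ext fun A hA => ?_
  rw [Measure.restrict_apply hA, Measure.restrict_apply hA, ← measureReal_eq_measureReal_iff,
    real_inter_of_tendsto_dTVfun_dpkSeq hXmeas hQ hP hxsurj hlim hA,
    real_inter_of_tendsto_dTVfun_dpkSeq hXmeas hQ hP hx'surj hlim' hA]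
end

section
/- Every probability measure P in the core of the updated lower probability, core(𝒫'_low) := { P a probability measure on (Ω, F) : P(A) ≥ 𝒫'_low(A) for all A ∈ F }, satisfies, for every A ∈ F, Σ_{j : E_j ≠ ∅} B_low(A|E_j) · q_j ≤ P(A) ≤ Σ_{j : E_j ≠ ∅} B_up(A|E_j) · q_j. -/
open MeasureTheory Finset
open scoped Classical

variable {Ω : Type*} [MeasurableSpace Ω]

/-- Lower probability of a set of probability measures: `𝒬_low(A) := inf_{P ∈ 𝒬} P(A)`. -/
noncomputable def lowProb (𝒮 : Set (Measure Ω)) (A : Set Ω) : ℝ :=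
  ⨅ P : 𝒮, ((P : Measure Ω) A).toReal

/-- Upper probability of a set of probability measures: `𝒬_up(A) := sup_{P ∈ 𝒬} P(A)`. -/
noncomputable def upProb (𝒮 : Set (Measure Ω)) (A : Set Ω) : ℝ :=
  ⨆ P : 𝒮, ((P : Measure Ω) A).toReal

/-- The Jeffrey (DPK) update of `P` with respect to the partition `E` and weights `q`:
`P'(A) := ∑_{j : E_j ≠ ∅} (P(A ∩ E_j)/P(E_j)) · q_j`. -/
noncomputable def jUpdate (P : Measure Ω) {m : ℕ} (E : Fin m → Set Ω)
    (q : Fin m → ℝ) (A : Set Ω) : ℝ :=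
  ∑ j ∈ Finset.univ.filter (fun j => E j ≠ ∅),
    ((P (A ∩ E j)).toReal / (P (E j)).toReal) * q j

/-- Lower probability of the updated set `𝒮' = {P' : P ∈ 𝒮}`. -/
noncomputable def jLow (𝒮 : Set (Measure Ω)) {m : ℕ} (E : Fin m → Set Ω)
    (q : Fin m → ℝ) (A : Set Ω) : ℝ :=
  ⨅ P : 𝒮, jUpdate (P : Measure Ω) E q A

/-- Upper probability of the updated set `𝒮' = {P' : P ∈ 𝒮}`. -/
noncomputable def jUp (𝒮 : Set (Measure Ω)) {m : ℕ} (E : Fin m → Set Ω)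
    (q : Fin m → ℝ) (A : Set Ω) : ℝ :=
  ⨆ P : 𝒮, jUpdate (P : Measure Ω) E q A

/-- Generalized Bayes conditional lower probability:
`B_low(A|B) := inf_{P ∈ 𝒮} P(A ∩ B)/P(B)`. -/
noncomputable def bayesLow (𝒮 : Set (Measure Ω)) (A B : Set Ω) : ℝ :=
  ⨅ P : 𝒮, ((P : Measure Ω) (A ∩ B)).toReal / ((P : Measure Ω) B).toReal

/-- Generalized Bayes conditional upper probability:
`B_up(A|B) := sup_{P ∈ 𝒮} P(A ∩ B)/P(B)`. -/
noncomputable def bayesUp (𝒮 : Set (Measure Ω)) (A B : Set Ω) : ℝ :=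
  ⨆ P : 𝒮, ((P : Measure Ω) (A ∩ B)).toReal / ((P : Measure Ω) B).toReal

/-- Geometric conditional lower probability: `G_low(A|B) := 𝒮_low(A ∩ B)/𝒮_low(B)`. -/
noncomputable def geomLow (𝒮 : Set (Measure Ω)) (A B : Set Ω) : ℝ :=
  lowProb 𝒮 (A ∩ B) / lowProb 𝒮 B

/-- Geometric conditional upper probability: `G_up(A|B) := 𝒮_up(A ∩ B)/𝒮_up(B)`. -/
noncomputable def geomUp (𝒮 : Set (Measure Ω)) (A B : Set Ω) : ℝ :=
  upProb 𝒮 (A ∩ B) / upProb 𝒮 B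

lemma toReal_inter_div_le_one (P : Measure Ω) [IsFiniteMeasure P] (A B : Set Ω) :
    (P (A ∩ B)).toReal / (P B).toReal ≤ 1 :=
  div_le_one_of_le₀
    (ENNReal.toReal_mono (measure_ne_top P B) (measure_mono Set.inter_subset_right))
    ENNReal.toReal_nonneg

lemma toReal_compl_inter_div (P : Measure Ω) [IsFiniteMeasure P] {A B : Set Ω}
    (hA : MeasurableSet A) (hB : 0 < P B) :
    (P (Aᶜ ∩ B)).toReal / (P B).toReal = 1 - (P (A ∩ B)).toReal / (P B).toReal := by
  have hB' : 0 < (P B).toReal := ENNReal.toReal_pos hB.ne' (measure_ne_top P B)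
  have h : (P (A ∩ B)).toReal + (P (Aᶜ ∩ B)).toReal = (P B).toReal := by
    rw [← ENNReal.toReal_add (measure_ne_top _ _) (measure_ne_top _ _),
      Set.inter_comm A, Set.inter_comm Aᶜ, ← Set.sdiff_eq, measure_inter_add_sdiff B hA]
  rw [eq_sub_iff_add_eq, ← add_div, add_comm, h, div_self hB'.ne']

lemma bayesLow_le {𝒮 : Set (Measure Ω)} {P : Measure Ω} (hP : P ∈ 𝒮) (A B : Set Ω) :
    bayesLow 𝒮 A B ≤ (P (A ∩ B)).toReal / (P B).toReal :=
  ciInf_le (f := fun P : 𝒮 => ((P : Measure Ω) (A ∩ B)).toReal / ((P : Measure Ω) B).toReal)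
    ⟨0, by rintro _ ⟨Q, rfl⟩; positivity⟩ ⟨P, hP⟩

lemma le_bayesUp {𝒮 : Set (Measure Ω)} (h𝒮 : ∀ P ∈ 𝒮, IsProbabilityMeasure P)
    {P : Measure Ω} (hP : P ∈ 𝒮) (A B : Set Ω) :
    (P (A ∩ B)).toReal / (P B).toReal ≤ bayesUp 𝒮 A B :=
  le_ciSup (f := fun P : 𝒮 => ((P : Measure Ω) (A ∩ B)).toReal / ((P : Measure Ω) B).toReal)
    ⟨1, by
      rintro _ ⟨Q, rfl⟩
      have := h𝒮 Q Q.2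
      exact toReal_inter_div_le_one _ A B⟩ ⟨P, hP⟩

lemma jUpdate_compl (P : Measure Ω) [IsFiniteMeasure P] {m : ℕ} {E : Fin m → Set Ω}
    {q : Fin m → ℝ} (hq1 : ∑ j, q j = 1) (hqempty : ∀ j, E j = ∅ → q j = 0)
    (hpos : ∀ j, E j ≠ ∅ → 0 < P (E j)) {A : Set Ω} (hA : MeasurableSet A) :
    jUpdate P E q Aᶜ = 1 - jUpdate P E q A := by
  have hsum : ∑ j ∈ Finset.univ.filter (fun j => E j ≠ ∅), q j = 1 := by
    rw [← hq1]
    exact Finset.sum_filter_of_ne fun j _ hj hE => hj (hqempty j hE)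
  rw [← hsum, jUpdate, jUpdate, ← Finset.sum_sub_distrib]
  refine Finset.sum_congr rfl fun j hj => ?_
  rw [toReal_compl_inter_div P hA (hpos j (Finset.mem_filter.1 hj).2)]
  ring

/-- every probability measure `P` in the core of the updated lower
probability satisfies, for every `A ∈ F`,
`∑_{j : E_j ≠ ∅} B_low(A|E_j) · q_j ≤ P(A) ≤ ∑_{j : E_j ≠ ∅} B_up(A|E_j) · q_j`. -/
theorem core_of_updated_lower_bounds
    (𝒮 : Set (Measure Ω)) (h𝒮ne : 𝒮.Nonempty)
    (h𝒮prob : ∀ P ∈ 𝒮, IsProbabilityMeasure P)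
    {m : ℕ} (E : Fin m → Set Ω) (hEmeas : ∀ j, MeasurableSet (E j))
    (hEdisj : Pairwise (Function.onFun Disjoint E))
    (hEcover : (⋃ j, E j) = Set.univ)
    (q : Fin m → ℝ) (hq0 : ∀ j, 0 ≤ q j) (hq1 : ∑ j, q j = 1)
    (hqempty : ∀ j, E j = ∅ → q j = 0)
    (hpos : ∀ P ∈ 𝒮, ∀ j, E j ≠ ∅ → 0 < (P : Measure Ω) (E j))
    :
    ∀ μ : Measure Ω, IsProbabilityMeasure μ →
      (∀ A : Set Ω, MeasurableSet A → jLow 𝒮 E q A ≤ (μ A).toReal) →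
      ∀ A : Set Ω, MeasurableSet A →
        (∑ j ∈ Finset.univ.filter (fun j => E j ≠ ∅), bayesLow 𝒮 A (E j) * q j)
          ≤ (μ A).toReal ∧
        (μ A).toReal
          ≤ ∑ j ∈ Finset.univ.filter (fun j => E j ≠ ∅), bayesUp 𝒮 A (E j) * q j := by
  intro μ hμ hcore A hA
  have : Nonempty 𝒮 := h𝒮ne.to_subtype
  refine ⟨le_trans (le_ciInf fun P => ?_) (hcore A hA), ?_⟩
  · exact Finset.sum_le_sum fun j _ =>
      mul_le_mul_of_nonneg_right (bayesLow_le P.2 A (E j)) (hq0 j)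
  · have hlow : 1 - ∑ j ∈ Finset.univ.filter (fun j => E j ≠ ∅), bayesUp 𝒮 A (E j) * q j
        ≤ jLow 𝒮 E q Aᶜ := by
      refine le_ciInf fun P => ?_
      have := h𝒮prob P P.2
      rw [jUpdate_compl _ hq1 hqempty (hpos P P.2) hA]
      exact sub_le_sub_left (Finset.sum_le_sum fun j _ =>
        mul_le_mul_of_nonneg_right (le_bayesUp h𝒮prob P.2 A (E j)) (hq0 j)) 1
    have hcompl : (μ Aᶜ).toReal = 1 - (μ A).toReal := probReal_compl_eq_one_sub hA
    linarith [hcore Aᶜ hA.compl]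
end
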